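/- arXiv:1810.10507 — 7 statements merged into one kernel-verified Lean document; each statement's English description precedes it below -/
import Mathlib

section
/- Let n ≥ 1 and let f : ℝⁿ → ℝ be real analytic on a neighborhood U of 0 with f(0) = 0 and ∇f(0) = 0. Assume there exist 0 < g < 1, an integer 0 ≤ k ≤ n−1, and r₀ > 0 such that for every 0 < r < r₀ there is c_r > 0 with m({x : |x| < r, |f(x)| < ε}) = c_r ε^g (log(1/ε))^k + o(ε^g (log(1/ε))^k) as ε → 0⁺. Let φ : ℝⁿ → ℝ be smooth, compactly supported in U, nonnegative, and strictly positive on some neighborhood of 0. Then for every h > g there is no constant C > 0 such that |∫_{ℝⁿ} φ(x) e^{−i(ξ_{n+1} f(x) + ξ₁x₁ + ⋯ + ξₙxₙ)} dx| ≤ C |ξ|^{−h} for all ξ ∈ ℝ^{n+1} with |ξ| > 2; in fact, for every C > 0 and h > g there exists λ > 2 with |∫_{ℝⁿ} φ(x) e^{−iλ f(x)} dx| > C λ^{−h}. -/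
open MeasureTheory Filter Topology Asymptotics Complex

/-- `|x| ^ s * exp (-x²)` is integrable on the whole line when `s > -1`. -/
theorem integrable_abs_rpow_mul_exp_neg_sq {s : ℝ} (hs : -1 < s) :
    Integrable fun x : ℝ => |x| ^ s * Real.exp (-x ^ 2) := by
  have hpos : IntegrableOn (fun x : ℝ => |x| ^ s * Real.exp (-x ^ 2)) (Set.Ioi 0) := by
    refine (integrableOn_rpow_mul_exp_neg_mul_sq one_pos hs).congr_fun (fun x hx => ?_)
      measurableSet_Ioi
    simp [abs_of_pos (Set.mem_Ioi.1 hx)]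
  rw [← integrableOn_univ, ← Set.Iic_union_Ioi (a := (0 : ℝ)), integrableOn_union]
  refine ⟨?_, hpos⟩
  rw [integrableOn_Iic_iff_integrableOn_Iio]
  have := hpos.comp_neg
  simpa using this

section
variable {E : Type*} [MeasurableSpace E] {μ : Measure E}

/-- Averaging an oscillatory integral against a Gaussian weight in the frequency localizes the
amplitude to the region where the phase is small. -/
theorem integral_exp_neg_sq_mul_oscillatory [SFinite μ] {ψ F : E → ℝ} (hψ : Integrable ψ μ)
    (hF : Measurable F) :
    ∫ t : ℝ, cexp (-(t : ℂ) ^ 2) * ∫ x, (ψ x : ℂ) * cexp (-I * ((t * F x : ℝ) : ℂ)) ∂μ =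
      ((√Real.pi * ∫ x, ψ x * Real.exp (-F x ^ 2 / 4) ∂μ : ℝ) : ℂ) := by
  have hgauss : Integrable fun t : ℝ => cexp (-(t : ℂ) ^ 2) := by
    simpa using integrable_cexp_neg_mul_sq (b := 1) (by simp)
  have hint : Integrable (Function.uncurry fun (t : ℝ) (x : E) =>
      cexp (-(t : ℂ) ^ 2) * ((ψ x : ℂ) * cexp (-I * ((t * F x : ℝ) : ℂ))))
      (volume.prod μ) := by
    have hprod := hgauss.mul_prod (hψ.ofReal (𝕜 := ℂ))
    have hmeas : Measurable fun p : ℝ × E => cexp (-I * ((p.1 * F p.2 : ℝ) : ℂ)) := by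
      fun_prop
    refine (hprod.bdd_mul (c := 1) hmeas.aestronglyMeasurable
      (ae_of_all _ fun p => ?_)).congr (ae_of_all _ fun p => ?_)
    · rw [Complex.norm_exp]; simp
    · simp only [Function.uncurry]; ring_nf; rfl
  have hfiber (x : E) : ∫ t : ℝ, cexp (-(t : ℂ) ^ 2) *
      ((ψ x : ℂ) * cexp (-I * ((t * F x : ℝ) : ℂ))) =
      ((√Real.pi * (ψ x * Real.exp (-F x ^ 2 / 4)) : ℝ) : ℂ) := by
    have h := fourierIntegral_gaussian (b := 1) (by simp) (-(F x : ℂ))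
    have hsqrt : (Real.pi : ℂ) ^ (1 / 2 : ℂ) = (√Real.pi : ℂ) := by
      rw [Real.sqrt_eq_rpow, Complex.ofReal_cpow Real.pi_pos.le]; norm_num
    rw [div_one, hsqrt] at h
    calc _ = (ψ x : ℂ) * ∫ t : ℝ, cexp (I * -(F x : ℂ) * t) * cexp (-1 * (t : ℂ) ^ 2) := by
          rw [← integral_const_mul]
          congr 1 with t
          push_cast
          ring_nf
      _ = _ := by
          rw [h]
          push_cast
          ring_nf
  simp_rw [← integral_const_mul]
  rw [integral_integral_swap hint]
  simp_rw [hfiber]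
  exact integral_ofReal

/-- Decay of order `h < 1` of an oscillatory integral forces the same order of smallness
for the mass of the amplitude near the zero set of the phase. -/
theorem exists_integral_mul_exp_neg_sq_le [SFinite μ] {ψ F : E → ℝ} (hψ : Integrable ψ μ)
    (hF : Measurable F) {h C : ℝ} (hh : h < 1)
    (hdecay : ∀ t : ℝ, t ≠ 0 →
      ‖∫ x, (ψ x : ℂ) * cexp (-I * ((t * F x : ℝ) : ℂ)) ∂μ‖ ≤ C * |t| ^ (-h)) :
    ∃ D : ℝ, ∀ ε : ℝ, 0 < ε →
      ∫ x, ψ x * Real.exp (-(F x / ε) ^ 2 / 4) ∂μ ≤ D * ε ^ h := by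
  refine ⟨(√Real.pi)⁻¹ * (C * ∫ t : ℝ, |t| ^ (-h) * Real.exp (-t ^ 2)), fun ε hε => ?_⟩
  have hpi : 0 < √Real.pi := Real.sqrt_pos.2 Real.pi_pos
  have hid := integral_exp_neg_sq_mul_oscillatory (μ := μ) hψ (hF.div_const ε)
  have hbound : ‖∫ t : ℝ, cexp (-(t : ℂ) ^ 2) *
      ∫ x, (ψ x : ℂ) * cexp (-I * ((t * (F x / ε) : ℝ) : ℂ)) ∂μ‖ ≤
      ∫ t : ℝ, (C * ε ^ h) * (|t| ^ (-h) * Real.exp (-t ^ 2)) := by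
    refine norm_integral_le_of_norm_le
      ((integrable_abs_rpow_mul_exp_neg_sq (by linarith)).const_mul _) ?_
    have hne : ∀ᵐ t : ℝ, t ≠ 0 := by simp [ae_iff]
    filter_upwards [hne] with t ht
    have hd := hdecay (t / ε) (div_ne_zero ht hε.ne')
    have hexp : ‖cexp (-(t : ℂ) ^ 2)‖ = Real.exp (-t ^ 2) := by
      rw [Complex.norm_exp, ← Complex.ofReal_pow, ← Complex.ofReal_neg, Complex.ofReal_re]
    have hpow : |t / ε| ^ (-h) = ε ^ h * |t| ^ (-h) := by
      rw [abs_div, abs_of_pos hε, Real.div_rpow (abs_nonneg t) hε.le, Real.rpow_neg hε.le,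
        div_inv_eq_mul, mul_comm]
    rw [norm_mul, hexp]
    calc _ = Real.exp (-t ^ 2) *
            ‖∫ x, (ψ x : ℂ) * cexp (-I * ((t / ε * F x : ℝ) : ℂ)) ∂μ‖ := by
          simp only [mul_div_assoc', div_mul_eq_mul_div]
      _ ≤ Real.exp (-t ^ 2) * (C * |t / ε| ^ (-h)) := by gcongr
      _ = _ := by rw [hpow]; ring
  rw [hid, integral_const_mul, Complex.norm_real] at hbound
  rw [mul_assoc, le_inv_mul_iff₀ hpi]
  calc _ ≤ _ := (le_abs_self _).trans hbound
    _ = _ := by ring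

/-- The mass of the sublevel set `{|F| < ε}` inside a region where the amplitude is at least `δ` is
controlled by the Gaussian localization of the amplitude. -/
theorem measureReal_sublevel_le {ψ F : E → ℝ} (hψ : Integrable ψ μ) (hψ0 : ∀ x, 0 ≤ ψ x)
    (hF : Measurable F) {S : Set E} (hS : MeasurableSet S) (hSfin : μ S ≠ ⊤) {δ : ℝ}
    (hδ : ∀ x ∈ S, δ ≤ ψ x) {ε : ℝ} (hε : 0 < ε) :
    δ * Real.exp (-1 / 4) * μ.real (S ∩ {x | |F x| < ε}) ≤
      ∫ x, ψ x * Real.exp (-(F x / ε) ^ 2 / 4) ∂μ := by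
  have hT : MeasurableSet (S ∩ {x | |F x| < ε}) :=
    hS.inter (measurableSet_lt hF.abs measurable_const)
  have hTfin : μ (S ∩ {x | |F x| < ε}) ≠ ⊤ :=
    measure_ne_top_of_subset Set.inter_subset_left hSfin
  have hright : Integrable (fun x => ψ x * Real.exp (-(F x / ε) ^ 2 / 4)) μ := by
    have hm : Measurable fun x => Real.exp (-(F x / ε) ^ 2 / 4) := by fun_prop
    refine hψ.mul_bdd (c := 1) hm.aestronglyMeasurable (ae_of_all _ fun x => ?_)
    rw [Real.norm_eq_abs, Real.abs_exp, Real.exp_le_one_iff]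
    have := sq_nonneg (F x / ε)
    linarith
  calc _ = ∫ x, (S ∩ {x | |F x| < ε}).indicator (fun _ => δ * Real.exp (-1 / 4)) x ∂μ := by
        rw [integral_indicator_const _ hT, smul_eq_mul, mul_comm]
    _ ≤ _ := by
        refine integral_mono ((integrable_indicator_iff hT).2 (integrableOn_const hTfin)) hright
          fun x => Set.indicator_apply_le' (fun hx => ?_) fun _ => ?_
        · have hlt : |F x / ε| ≤ 1 := by
            rw [abs_div, abs_of_pos hε, div_le_one hε]
            exact hx.2.le
          have hsq : (F x / ε) ^ 2 ≤ 1 := (sq_le_one_iff_abs_le_one _).2 hlt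
          exact mul_le_mul (hδ x hx.1) (Real.exp_le_exp.2 (by linarith)) (Real.exp_pos _).le
            (hψ0 x)
        · exact mul_nonneg (hψ0 x) (Real.exp_pos _).le

/-- A bound `C t ^ (-h)` for `t > 2` on an oscillatory integral extends to a bound with any smaller
nonnegative exponent for all nonzero frequencies. -/
theorem exists_norm_oscillatory_le {ψ F : E → ℝ} {h h' C : ℝ} (hC : 0 ≤ C)
    (h0 : 0 ≤ h') (hh : h' ≤ h)
    (hdecay : ∀ t : ℝ, 2 < t →
      ‖∫ x, (ψ x : ℂ) * cexp (-I * ((t * F x : ℝ) : ℂ)) ∂μ‖ ≤ C * t ^ (-h)) :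
    ∃ C' : ℝ, ∀ t : ℝ, t ≠ 0 →
      ‖∫ x, (ψ x : ℂ) * cexp (-I * ((t * F x : ℝ) : ℂ)) ∂μ‖ ≤ C' * |t| ^ (-h') := by
  set A : ℝ := ∫ x, |ψ x| ∂μ
  have hA : 0 ≤ A := integral_nonneg fun x => abs_nonneg _
  have hpos : ∀ t : ℝ, 0 < t → ‖∫ x, (ψ x : ℂ) * cexp (-I * ((t * F x : ℝ) : ℂ)) ∂μ‖ ≤
      (C + A * 2 ^ h') * t ^ (-h') := by
    intro t ht
    have htp : 0 < t ^ (-h') := Real.rpow_pos_of_pos ht _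
    have h2p : (0 : ℝ) < 2 ^ h' := by positivity
    rcases lt_or_ge 2 t with h2 | h2
    · refine (hdecay t h2).trans ?_
      gcongr
      · linarith [mul_nonneg hA h2p.le]
      · linarith
    · calc _ ≤ A := by
            refine (norm_integral_le_integral_norm _).trans_eq ?_
            congr 1 with x
            rw [norm_mul, Complex.norm_exp]
            simp
        _ ≤ A * (2 ^ h' * t ^ (-h')) := by
            refine le_mul_of_one_le_right hA ?_
            rw [Real.rpow_neg ht.le, ← div_eq_mul_inv, one_le_div (by positivity)]
            gcongr
        _ ≤ _ := by
            rw [← mul_assoc]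
            gcongr
            linarith
  refine ⟨C + A * 2 ^ h', fun t ht => ?_⟩
  rcases ht.lt_or_gt with ht | ht
  · rw [abs_of_neg ht]
    convert hpos (-t) (by linarith) using 1
    rw [← RCLike.norm_conj, ← integral_conj]
    congr 2 with x
    simp [← Complex.exp_conj]
  · rw [abs_of_pos ht]
    exact hpos t ht

end

/-- A function asymptotic to `c ε ^ g (log (1 / ε)) ^ k` with `c > 0` is not `O(ε ^ h)` for
`h > g`. -/
theorem not_forall_le_rpow_of_isLittleO {M : ℝ → ℝ} {c g h D : ℝ} {k : ℕ} (hc : 0 < c)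
    (hgh : g < h)
    (hM : (fun ε : ℝ => M ε - c * ε ^ g * Real.log (1 / ε) ^ k)
      =o[𝓝[>] (0 : ℝ)] fun ε : ℝ => ε ^ g * Real.log (1 / ε) ^ k) :
    ¬ ∀ ε : ℝ, 0 < ε → M ε ≤ D * ε ^ h := by
  intro hD
  have hlim : Tendsto (fun ε : ℝ => D * ε ^ (h - g)) (𝓝[>] 0) (𝓝 0) := by
    have := (Real.continuousAt_rpow_const 0 (h - g) (Or.inr (by linarith))).tendsto.const_mul D
    rw [Real.zero_rpow (by linarith), mul_zero] at this
    exact this.mono_left nhdsWithin_le_nhds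
  have hsmall : ∀ᶠ ε : ℝ in 𝓝[>] 0, ε < Real.exp (-1) :=
    nhdsWithin_le_nhds (Iio_mem_nhds (Real.exp_pos _))
  obtain ⟨ε, hε, hlit, hlt, hε0⟩ := ((hlim.eventually_lt_const (half_pos hc)).and
    ((hM.def (half_pos hc)).and (hsmall.and self_mem_nhdsWithin))).exists
  replace hε0 : 0 < ε := hε0
  have hlog : 1 ≤ Real.log (1 / ε) := by
    rw [one_div, Real.log_inv]
    have := Real.log_lt_log hε0 hlt
    rw [Real.log_exp] at this
    linarith
  have hlogk : 1 ≤ Real.log (1 / ε) ^ k := one_le_pow₀ hlog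
  have hεg : 0 < ε ^ g := Real.rpow_pos_of_pos hε0 _
  have hprod : ε ^ g ≤ ε ^ g * Real.log (1 / ε) ^ k := le_mul_of_one_le_right hεg.le hlogk
  rw [Real.norm_eq_abs, Real.norm_eq_abs, abs_of_pos (hεg.trans_le hprod)] at hlit
  have hlow := neg_le_of_abs_le hlit
  have hsplit : D * ε ^ h = D * ε ^ (h - g) * ε ^ g := by
    rw [mul_assoc, ← Real.rpow_add hε0, sub_add_cancel]
  have hup := hD ε hε0
  have h1 := mul_lt_mul_of_pos_right hε hεg
  have h2 := mul_le_mul_of_nonneg_left hprod (half_pos hc).le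
  rw [hsplit] at hup
  linarith

/-- sharpness of the decay exponent `g` for the oscillatory integral,
when `g < 1`. -/
theorem stmt3
    (n : ℕ) (hn : 1 ≤ n)
    (f : EuclideanSpace ℝ (Fin n) → ℝ)
    (U : Set (EuclideanSpace ℝ (Fin n))) (hU : U ∈ 𝓝 (0 : EuclideanSpace ℝ (Fin n)))
    (hfa : AnalyticOnNhd ℝ f U) (hf0 : f 0 = 0) (hdf : fderiv ℝ f 0 = 0)
    (g : ℝ) (hg0 : 0 < g) (hg1 : g < 1)
    (k : ℕ) (hk : k ≤ n - 1)
    (r₀ : ℝ) (hr₀ : 0 < r₀)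
    (hasymp : ∀ r : ℝ, 0 < r → r < r₀ → ∃ c : ℝ, 0 < c ∧
      (fun ε : ℝ =>
          (volume {x : EuclideanSpace ℝ (Fin n) | ‖x‖ < r ∧ |f x| < ε}).toReal
            - c * ε ^ g * (Real.log (1 / ε)) ^ k)
        =o[𝓝[>] (0 : ℝ)] fun ε : ℝ => ε ^ g * (Real.log (1 / ε)) ^ k)
    (φ : EuclideanSpace ℝ (Fin n) → ℝ)
    (hφs : ContDiff ℝ (⊤ : ℕ∞) φ) (hφc : HasCompactSupport φ) (hφU : tsupport φ ⊆ U)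
    (hφnn : ∀ x, 0 ≤ φ x)
    (hφpos : ∃ V ∈ 𝓝 (0 : EuclideanSpace ℝ (Fin n)), ∀ x ∈ V, 0 < φ x) :
    (∀ h : ℝ, g < h →
      ¬ ∃ C : ℝ, 0 < C ∧
        ∀ ξ : EuclideanSpace ℝ (Fin (n + 1)), 2 < ‖ξ‖ →
          ‖∫ x : EuclideanSpace ℝ (Fin n),
              (φ x : ℂ) * Complex.exp (-(Complex.I) *
                ((ξ (Fin.last n) * f x + ∑ i : Fin n, ξ i.castSucc * x i : ℝ) : ℂ))‖
            ≤ C * ‖ξ‖ ^ (-h)) ∧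
    (∀ C : ℝ, 0 < C → ∀ h : ℝ, g < h →
      ∃ lam : ℝ, 2 < lam ∧
        C * lam ^ (-h) <
          ‖∫ x : EuclideanSpace ℝ (Fin n),
              (φ x : ℂ) * Complex.exp (-(Complex.I) * ((lam * f x : ℝ) : ℂ))‖) := by
  have hlower : ∀ C : ℝ, 0 < C → ∀ h : ℝ, g < h →
      ∃ lam : ℝ, 2 < lam ∧
        C * lam ^ (-h) <
          ‖∫ x : EuclideanSpace ℝ (Fin n),
              (φ x : ℂ) * Complex.exp (-(Complex.I) * ((lam * f x : ℝ) : ℂ))‖ := by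
    intro C hC h hgh
    by_contra! hdecay
    have hKmeas : MeasurableSet (tsupport φ) := (isClosed_tsupport φ).measurableSet
    -- `f` need not be measurable away from `U`, so it is cut off outside the support of `φ`.
    set F : EuclideanSpace ℝ (Fin n) → ℝ := (tsupport φ).indicator f
    have hF : Measurable F := by
      classical
      have hfc : ContinuousOn f (tsupport φ) := hfa.continuousOn.mono hφU
      have := hfc.measurable_piecewise (g := 0) continuousOn_const hKmeas
      rwa [Set.piecewise_eq_indicator] at this
    have hFf : ∀ x, φ x ≠ 0 → F x = f x := fun x hx =>
      Set.indicator_of_mem (subset_tsupport φ hx) f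
    have hφint : Integrable φ := hφs.continuous.integrable_of_hasCompactSupport hφc
    obtain ⟨h', hgh', hh', hh1⟩ : ∃ h' : ℝ, g < h' ∧ h' ≤ h ∧ h' < 1 :=
      ⟨min h ((g + 1) / 2), lt_min hgh (by linarith), min_le_left _ _,
        (min_le_right _ _).trans_lt (by linarith)⟩
    obtain ⟨C', hC'⟩ := exists_norm_oscillatory_le (μ := volume) (ψ := φ) (F := F) hC.le
      (hg0.trans hgh').le hh' fun t ht => by
        refine (congrArg norm (integral_congr_ae (ae_of_all _ fun x => ?_))).trans_le
          (hdecay t ht)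
        rcases eq_or_ne (φ x) 0 with hx | hx
        · simp [hx]
        · rw [hFf x hx]
    obtain ⟨D, hD⟩ := exists_integral_mul_exp_neg_sq_le hφint hF hh1 hC'
    obtain ⟨V, hV, hVpos⟩ := hφpos
    have hφ0 : 0 < φ 0 := hVpos 0 (mem_of_mem_nhds hV)
    obtain ⟨ρ, hρ, hball⟩ := Metric.eventually_nhds_iff_ball.1
      (hφs.continuous.continuousAt.eventually_const_lt (half_lt_self hφ0))
    set r := min ρ (r₀ / 2)
    have hr : 0 < r := lt_min hρ (by linarith)
    obtain ⟨c, hc, hasym⟩ := hasymp r hr ((min_le_right _ _).trans_lt (by linarith))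
    have hφr : ∀ x ∈ Metric.ball (0 : EuclideanSpace ℝ (Fin n)) r, φ 0 / 2 ≤ φ x := fun x hx =>
      (hball x (Metric.ball_subset_ball (min_le_left _ _) hx)).le
    have hE : 0 < φ 0 / 2 * Real.exp (-1 / 4) := by positivity
    refine not_forall_le_rpow_of_isLittleO (D := (φ 0 / 2 * Real.exp (-1 / 4))⁻¹ * D) hc hgh' hasym
      fun ε hε => ?_
    have hset : {x | ‖x‖ < r ∧ |f x| < ε} = Metric.ball 0 r ∩ {x | |F x| < ε} := by
      ext x
      simp only [Set.mem_ofPred_eq, Set.mem_inter_iff, mem_ball_zero_iff]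
      refine and_congr_right fun hx => ?_
      rw [hFf x (by have := hφr x (mem_ball_zero_iff.2 hx); linarith)]
    rw [hset, mul_assoc, le_inv_mul_iff₀ hE]
    exact (measureReal_sublevel_le hφint hφnn hF measurableSet_ball measure_ball_lt_top.ne hφr
      hε).trans (hD ε hε)
  refine ⟨fun h hgh => ?_, hlower⟩
  rintro ⟨C, hC, hbound⟩
  obtain ⟨lam, hlam, hlt⟩ := hlower C hC h hgh
  have hnorm : ‖EuclideanSpace.single (Fin.last n) lam‖ = lam := by
    rw [PiLp.norm_single, Real.norm_of_nonneg (by linarith)]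
  have hle := hbound (EuclideanSpace.single (Fin.last n) lam) (by rwa [hnorm])
  rw [hnorm] at hle
  refine hlt.not_ge (le_of_eq_of_le ?_ hle)
  congr 2 with x
  simp [(Fin.castSucc_lt_last _).ne]
end

section
/- Let t be any positive rational number and write t = 1/(m + γ) where m is a nonnegative integer and 0 ≤ γ < 1. Then there exist a dimension n ≥ 1, a real analytic function q : ℝⁿ → ℝ with q(0) = 0 whose sublevel growth expansion holds with index pair (h, l) = (t, 0) (that is, for all sufficiently small r > 0, m({x : |x| < r, |q(x)| < ε}) = c_r ε^t + o(ε^t) as ε → 0⁺ with c_r > 0), real analytic functions s₁,…,s_{m+1} on ℝⁿ with s_i(0) = 0, and an exponent h' < t, such that there are NO constants δ, r₁, C > 0 for which every function of the form s(x) = Σ_{i=1}^{m+1} η_i s_i(x) with each |η_i| < δ satisfies m({x : |x| < r₁, |q(x) + s(x)| < ε}) ≤ C ε^{h'} for all 0 < ε < 1/2. In other words, the number m of perturbation functions in the stability theorem cannot be increased to m + 1. -/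
open MeasureTheory Filter Topology Asymptotics

/-- Even powers of the norm of a real inner product space are real analytic. -/
theorem analyticOnNhd_norm_sq_pow {E : Type*} [NormedAddCommGroup E] [InnerProductSpace ℝ E]
    [CompleteSpace E] (k : ℕ) : AnalyticOnNhd ℝ (fun x : E => (‖x‖ ^ 2) ^ k) Set.univ :=
  contDiff_omega_iff_analyticOnNhd.1 ((contDiff_norm_sq ℝ).pow k)

/-- The volume of a ball of positive radius in terms of that of the unit ball. -/
theorem addHaar_real_ball_zero {E : Type*} [NormedAddCommGroup E]
    [NormedSpace ℝ E] [FiniteDimensional ℝ E] [MeasurableSpace E] [BorelSpace E]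
    (μ : Measure E) [μ.IsAddHaarMeasure] {r : ℝ} (hr : 0 < r) :
    μ.real (Metric.ball 0 r) = r ^ Module.finrank ℝ E * μ.real (Metric.ball 0 1) := by
  rw [measureReal_def, Measure.addHaar_ball_of_pos μ 0 hr, ENNReal.toReal_mul,
    ENNReal.toReal_ofReal (by positivity), measureReal_def]

/-- The volume of a sublevel set of `‖x‖ ^ (2 d)` that stays inside the ball of radius `r`. -/
theorem measureReal_sublevel_norm_sq_pow {E : Type*} [NormedAddCommGroup E]
    [NormedSpace ℝ E] [FiniteDimensional ℝ E] [MeasurableSpace E] [BorelSpace E]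
    (μ : Measure E) [μ.IsAddHaarMeasure] {d : ℕ} (hd : d ≠ 0) {r ε : ℝ} (hr : 0 < r)
    (hε : 0 < ε) (hεr : ε < r ^ (2 * d)) :
    μ.real {x | ‖x‖ < r ∧ |(‖x‖ ^ 2) ^ d| < ε} =
      μ.real (Metric.ball 0 1) * ε ^ ((Module.finrank ℝ E : ℝ) / (2 * d)) := by
  have h2d : 2 * d ≠ 0 := by positivity
  set R := ε ^ (((2 * d : ℕ) : ℝ)⁻¹) with hR
  have hRpos : 0 < R := Real.rpow_pos_of_pos hε _
  have hRpow : R ^ (2 * d) = ε := Real.rpow_inv_natCast_pow hε.le h2d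
  have hset : {x : E | ‖x‖ < r ∧ |(‖x‖ ^ 2) ^ d| < ε} = Metric.ball 0 R := by
    ext x
    simp only [Set.mem_ofPred_eq, mem_ball_zero_iff]
    rw [abs_of_nonneg (by positivity), ← pow_mul, ← hRpow,
      pow_lt_pow_iff_left₀ (norm_nonneg x) hRpos.le h2d]
    rw [← hRpow, pow_lt_pow_iff_left₀ hRpos.le hr.le h2d] at hεr
    exact ⟨fun h => h.2, fun h => ⟨h.trans hεr, h⟩⟩
  rw [hset, addHaar_real_ball_zero μ hRpos, hR, ← Real.rpow_mul_natCast hε.le, mul_comm]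
  congr 2
  push_cast
  ring

/-- A spherical shell of width `τ` and inner radius `R` has volume at least a constant times
`R ^ (dim - 1) * τ`. -/
theorem le_measureReal_shell {E : Type*} [NormedAddCommGroup E]
    [NormedSpace ℝ E] [FiniteDimensional ℝ E] [MeasurableSpace E] [BorelSpace E]
    (μ : Measure E) [μ.IsAddHaarMeasure] (hE : Module.finrank ℝ E ≠ 0) {R τ : ℝ} (hR : 0 < R)
    (hτ : 0 < τ) :
    R ^ (Module.finrank ℝ E - 1) * μ.real (Metric.ball 0 1) * τ ≤
      μ.real (Metric.ball 0 (R + τ) \ Metric.ball 0 R) := by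
  obtain ⟨k, hk⟩ := Nat.exists_eq_succ_of_ne_zero hE
  rw [measureReal_sdiff (Metric.ball_subset_ball (by linarith)) measurableSet_ball,
    addHaar_real_ball_zero μ hR, addHaar_real_ball_zero μ (add_pos hR hτ),
    hk, Nat.succ_eq_add_one, Nat.add_sub_cancel, ← sub_mul]
  have h1 : R ^ k ≤ (R + τ) ^ k := by gcongr; linarith
  have h2 : R ^ k * τ ≤ (R + τ) ^ (k + 1) - R ^ (k + 1) := by
    have : R ^ k * (R + τ) ≤ (R + τ) ^ k * (R + τ) := by gcongr
    rw [pow_succ, pow_succ]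
    linarith
  calc R ^ k * μ.real (Metric.ball 0 1) * τ = R ^ k * τ * μ.real (Metric.ball 0 1) := by ring
    _ ≤ _ := by gcongr

/-- A shell around the sphere of radius `R` lies in a sublevel set of a function vanishing to
order `c` on that sphere. -/
theorem shell_subset_sublevel {E : Type*} [NormedAddCommGroup E] {b c : ℕ} (hc : c ≠ 0)
    {R τ r : ℝ} (hR : 0 < R) (hτ : 0 < τ) (h1 : R + τ ≤ 1) (hr : R + τ ≤ r) :
    Metric.ball (0 : E) (R + τ) \ Metric.ball 0 R ⊆
      {x | ‖x‖ < r ∧ |(‖x‖ ^ 2) ^ b * (‖x‖ ^ 2 - R ^ 2) ^ c| < (2 * τ) ^ c} := by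
  intro x hx
  simp only [Set.mem_sdiff, mem_ball_zero_iff, not_lt] at hx
  obtain ⟨hx1, hx2⟩ := hx
  have hρ : 0 ≤ ‖x‖ ^ 2 - R ^ 2 := by nlinarith
  have hρ' : ‖x‖ ^ 2 - R ^ 2 < 2 * τ := by nlinarith
  refine ⟨hx1.trans_le hr, ?_⟩
  rw [abs_of_nonneg (by positivity)]
  have hb : (‖x‖ ^ 2) ^ b ≤ 1 :=
    pow_le_one₀ (by positivity) (pow_le_one₀ (norm_nonneg x) (hx1.le.trans h1))
  calc (‖x‖ ^ 2) ^ b * (‖x‖ ^ 2 - R ^ 2) ^ c ≤ 1 * (‖x‖ ^ 2 - R ^ 2) ^ c := by gcongr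
    _ = (‖x‖ ^ 2 - R ^ 2) ^ c := one_mul _
    _ < (2 * τ) ^ c := pow_lt_pow_left₀ hρ' hρ hc

/-- Expansion of `ρ ^ b * (ρ - u) ^ c` as a perturbation of `ρ ^ (b + c)`. -/
theorem pow_add_sum_eq_pow_mul_sub_pow (ρ u : ℝ) (b c : ℕ) :
    ρ ^ (b + c) + ∑ i : Fin c, (c.choose i * (-u) ^ (c - i)) * ρ ^ (b + i) =
      ρ ^ b * (ρ - u) ^ c := by
  rw [sub_eq_add_neg, add_pow, Finset.sum_range_succ,
    Fin.sum_univ_eq_sum_range (fun i => (c.choose i * (-u) ^ (c - i)) * ρ ^ (b + i)),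
    mul_add, Finset.mul_sum, add_comm]
  congr 1
  · refine Finset.sum_congr rfl fun i _ => ?_
    ring
  · simp [pow_add]

/-- For `p > 1`, multiples of `τ ^ p` are eventually smaller than `K * τ` as `τ → 0⁺`. -/
theorem eventually_mul_rpow_lt_mul {K p : ℝ} (C : ℝ) (hK : 0 < K) (hp : 1 < p) :
    ∀ᶠ τ : ℝ in 𝓝[>] 0, C * τ ^ p < K * τ := by
  have h : Tendsto (fun τ : ℝ => C * τ ^ (p - 1)) (𝓝[>] 0) (𝓝 0) := by
    have := ((Real.continuousAt_rpow_const 0 (p - 1) (Or.inr (by linarith))).tendsto.const_mul C)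
    rw [Real.zero_rpow (by linarith), mul_zero] at this
    exact this.mono_left nhdsWithin_le_nhds
  filter_upwards [h.eventually_lt_const hK, self_mem_nhdsWithin] with τ h1 (h2 : 0 < τ)
  have : τ ^ p = τ ^ (p - 1) * τ := by
    rw [← Real.rpow_add_one h2.ne', sub_add_cancel]
  rw [this, ← mul_assoc]
  gcongr

/-- sharpness of the number of perturbation functions in the stability
theorem: for any positive rational `t = 1/(m + γ)` with `0 ≤ γ < 1`, there is a dimension
`n`, a real analytic `q` with sublevel index pair `(t, 0)`, and `m + 1` real analytic
perturbation functions vanishing at `0`, together with an exponent `h' < t`, such that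
no uniform sublevel bound `≤ C ε^{h'}` holds over all small linear combinations of the
perturbations. -/
theorem stmt12
    (t : ℚ) (ht : 0 < t)
    (m : ℕ) (γ : ℝ) (hγ0 : 0 ≤ γ) (hγ1 : γ < 1)
    (htm : (t : ℝ) = 1 / (m + γ)) :
    ∃ n : ℕ, 1 ≤ n ∧
    ∃ q : EuclideanSpace ℝ (Fin n) → ℝ,
      AnalyticOnNhd ℝ q Set.univ ∧ q 0 = 0 ∧
      (∃ r₀ : ℝ, 0 < r₀ ∧ ∀ r : ℝ, 0 < r → r < r₀ → ∃ c : ℝ, 0 < c ∧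
        (fun ε : ℝ =>
            (volume {x : EuclideanSpace ℝ (Fin n) | ‖x‖ < r ∧ |q x| < ε}).toReal
              - c * ε ^ (t : ℝ))
          =o[𝓝[>] (0 : ℝ)] fun ε : ℝ => ε ^ (t : ℝ)) ∧
      ∃ s : Fin (m + 1) → EuclideanSpace ℝ (Fin n) → ℝ,
        (∀ i, AnalyticOnNhd ℝ (s i) Set.univ) ∧ (∀ i, s i 0 = 0) ∧
        ∃ h' : ℝ, h' < t ∧
          ¬ ∃ (δ r₁ C : ℝ), 0 < δ ∧ 0 < r₁ ∧ 0 < C ∧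
            ∀ η : Fin (m + 1) → ℝ, (∀ i, |η i| < δ) →
              ∀ ε : ℝ, 0 < ε → ε < 1 / 2 →
                (volume {x : EuclideanSpace ℝ (Fin n) |
                    ‖x‖ < r₁ ∧ |q x + ∑ i, η i * s i x| < ε}).toReal
                  ≤ C * ε ^ h' := by
  set c := m + 1 with hc
  have hc0 : c ≠ 0 := by omega
  have hk : 0 < t.den := t.den_pos
  obtain ⟨p, hp⟩ : ∃ p : ℕ, t.num = p := Int.eq_ofNat_of_zero_le (Rat.num_pos.2 ht).le
  have hp0 : 0 < p := by
    have := Rat.num_pos.2 ht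
    omega
  have htp : (t : ℝ) = p / t.den := by
    rw [Rat.cast_def, hp, Int.cast_natCast]
  obtain ⟨b, hbd, hb0⟩ : ∃ b, b + c = t.den * (c + 1) ∧ 0 < b :=
    have : c + 1 ≤ t.den * (c + 1) := Nat.le_mul_of_pos_left _ hk
    ⟨t.den * (c + 1) - c, by omega, by omega⟩
  have hct : 1 < (c : ℝ) * t := by
    have hmγ : 0 < (m : ℝ) + γ := by
      have : (0 : ℝ) < t := by exact_mod_cast ht
      rw [htm] at this
      exact one_div_pos.1 this
    rw [htm, mul_one_div, one_lt_div hmγ, hc]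
    push_cast
    linarith
  set n := 2 * (c + 1) * p with hn
  have hn0 : 0 < n := by positivity
  have hexp : (n : ℝ) / (2 * (b + c : ℕ)) = t := by
    rw [htp, hbd, hn]
    push_cast
    field_simp
  have hball : 0 < (volume : Measure (EuclideanSpace ℝ (Fin n))).real (Metric.ball 0 1) :=
    ENNReal.toReal_pos (Metric.measure_ball_pos _ _ one_pos).ne' measure_ball_lt_top.ne
  refine ⟨n, hn0, fun x => (‖x‖ ^ 2) ^ (b + c), analyticOnNhd_norm_sq_pow _, by simp [hc0],
    ⟨1, one_pos, fun r hr _ => ⟨_, hball, ?_⟩⟩,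
    fun i x => (‖x‖ ^ 2) ^ (b + i), fun i => analyticOnNhd_norm_sq_pow _,
    fun i => by simp [hb0.ne'], (1 / c + t) / 2, ?_, ?_⟩
  · refine (isLittleO_zero _ _).congr' ?_ EventuallyEq.rfl
    have hev : ∀ᶠ ε : ℝ in 𝓝[>] 0, ε < r ^ (2 * (b + c)) :=
      nhdsWithin_le_nhds (eventually_lt_nhds (by positivity))
    filter_upwards [hev, self_mem_nhdsWithin] with ε h1 (h2 : 0 < ε)
    have := measureReal_sublevel_norm_sq_pow (volume : Measure (EuclideanSpace ℝ (Fin n)))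
      (d := b + c) (by omega) hr h2 h1
    rw [finrank_euclideanSpace_fin, hexp] at this
    exact (sub_eq_zero.2 this).symm
  · have : 1 / (c : ℝ) < t := by
      rw [div_lt_iff₀' (by positivity)]
      exact hct
    linarith
  · rintro ⟨δ, r₁, C, hδ, hr₁, -, H⟩
    obtain ⟨R, hRδ, hR1, hRr, hR⟩ : ∃ R : ℝ,
        (∀ i : Fin c, |c.choose i * (-R ^ 2) ^ (c - i : ℕ)| < δ) ∧ R < 1 ∧ R < r₁ ∧ 0 < R := by
      have hev : ∀ᶠ R : ℝ in 𝓝 0,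
          ∀ i : Fin c, |c.choose i * (-R ^ 2) ^ (c - i : ℕ)| < δ := by
        refine eventually_all.2 fun i => ?_
        have hcont : Continuous fun R : ℝ => |c.choose i * (-R ^ 2) ^ (c - i : ℕ)| := by fun_prop
        refine hcont.tendsto 0 |>.eventually_lt_const ?_
        have : c - (i : ℕ) ≠ 0 := by omega
        simpa [this] using hδ
      have hev' := (hev.and ((eventually_lt_nhds one_pos).and (eventually_lt_nhds hr₁)))
      obtain ⟨R, ⟨h1, h2, h3⟩, h4⟩ :=
        ((hev'.filter_mono nhdsWithin_le_nhds).and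
          (self_mem_nhdsWithin : Set.Ioi (0 : ℝ) ∈ 𝓝[>] 0)).exists
      exact ⟨R, h1, h2, h3, h4⟩
    set K := R ^ (n - 1) * (volume : Measure (EuclideanSpace ℝ (Fin n))).real (Metric.ball 0 1)
      with hK
    have hKpos : 0 < K := by positivity
    set e : ℝ := c * ((1 / c + t) / 2) with he
    have he1 : 1 < e := by
      have : e = (1 + c * t) / 2 := by
        rw [he]
        field_simp
      linarith
    have hsmall : ∀ᶠ τ : ℝ in 𝓝[>] 0, τ < 1 - R ∧ τ < r₁ - R ∧ τ < 1 / 4 :=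
      nhdsWithin_le_nhds ((eventually_lt_nhds (by linarith)).and
        ((eventually_lt_nhds (by linarith)).and (eventually_lt_nhds (by norm_num))))
    obtain ⟨τ, ⟨h1, h2, h3⟩, hlt, hτ⟩ := (hsmall.and
      ((eventually_mul_rpow_lt_mul (C * 2 ^ e) hKpos he1).and self_mem_nhdsWithin)).exists
    replace hτ : 0 < τ := hτ
    have hε : (2 * τ) ^ c < 1 / 2 :=
      (pow_le_of_le_one (by positivity) (by linarith) hc0).trans_lt (by linarith)
    have hH := H (fun i => c.choose i * (-R ^ 2) ^ (c - i : ℕ)) hRδ ((2 * τ) ^ c)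
      (by positivity) hε
    simp only [pow_add_sum_eq_pow_mul_sub_pow] at hH
    have hle := le_measureReal_shell (volume : Measure (EuclideanSpace ℝ (Fin n)))
      (by rw [finrank_euclideanSpace_fin]; exact hn0.ne') hR hτ
    rw [finrank_euclideanSpace_fin] at hle
    have hmono := measureReal_mono (μ := (volume : Measure (EuclideanSpace ℝ (Fin n))))
      (shell_subset_sublevel (b := b) hc0 hR hτ (by linarith) (by linarith : R + τ ≤ r₁))
      (measure_ne_top_of_subset (s := Metric.ball (0 : EuclideanSpace ℝ (Fin n)) r₁)
        (fun x hx => mem_ball_zero_iff.2 hx.1)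
        measure_ball_lt_top.ne)
    have hpow : ((2 * τ) ^ c) ^ ((1 / (c : ℝ) + t) / 2) = 2 ^ e * τ ^ e := by
      rw [← Real.rpow_natCast_mul (by positivity), Real.mul_rpow (by norm_num) hτ.le]
    rw [hpow, ← mul_assoc] at hH
    exact absurd (hle.trans (hmono.trans hH)) (not_le.2 hlt)
end

section
/- Let a < b be real numbers and let h : [a,b] → ℝ be a C² function with |h'(x)| > A for all x ∈ [a,b], where A > 0, and suppose |h''(x)| < B·A/(b − a) on [a,b] for some constant B > 0. Let φ be a C¹ function on [a,b]. Then |∫_a^b e^{i h(x)} φ(x) dx| ≤ A^{−1} ( (B + 2)·sup_{x ∈ [a,b]} |φ(x)| + ∫_a^b |φ'(x)| dx ). -/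
open MeasureTheory intervalIntegral

/-- Integration by parts for an oscillatory integral whose phase `h` has nonvanishing
derivative `g`, where `k` is the derivative of `g` and `p` the derivative of the amplitude `φ`. -/
theorem integral_exp_mul_eq_boundary_add_integral {a b : ℝ} (hab : a ≤ b) {h g k φ p : ℝ → ℝ}
    (hh : ContinuousOn h (Set.Icc a b)) (hg : ContinuousOn g (Set.Icc a b))
    (hk : ContinuousOn k (Set.Icc a b)) (hφ : ContinuousOn φ (Set.Icc a b))
    (hp : ContinuousOn p (Set.Icc a b))
    (hh' : ∀ x ∈ Set.Ioo a b, HasDerivAt h (g x) x)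
    (hg' : ∀ x ∈ Set.Ioo a b, HasDerivAt g (k x) x)
    (hφ' : ∀ x ∈ Set.Ioo a b, HasDerivAt φ (p x) x)
    (hg0 : ∀ x ∈ Set.Icc a b, g x ≠ 0) :
    ∫ x in a..b, Complex.exp (Complex.I * (h x : ℂ)) * (φ x : ℂ) =
      (-Complex.I * Complex.exp (Complex.I * (h b : ℂ)) * ((φ b / g b : ℝ) : ℂ)
        - -Complex.I * Complex.exp (Complex.I * (h a : ℂ)) * ((φ a / g a : ℝ) : ℂ))
      + ∫ x in a..b, Complex.I * Complex.exp (Complex.I * (h x : ℂ)) *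
          (((p x * g x - φ x * k x) / g x ^ 2 : ℝ) : ℂ) := by
  have hE : ContinuousOn (fun x => Complex.exp (Complex.I * (h x : ℂ))) (Set.Icc a b) :=
    (continuousOn_const.mul (Complex.continuous_ofReal.comp_continuousOn hh)).cexp
  have c1 : ContinuousOn (fun x => Complex.exp (Complex.I * (h x : ℂ)) * (φ x : ℂ))
      (Set.Icc a b) := hE.mul (Complex.continuous_ofReal.comp_continuousOn hφ)
  have c2 : ContinuousOn (fun x => Complex.I * Complex.exp (Complex.I * (h x : ℂ)) *
      (((p x * g x - φ x * k x) / g x ^ 2 : ℝ) : ℂ)) (Set.Icc a b) :=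
    (continuousOn_const.mul hE).mul (Complex.continuous_ofReal.comp_continuousOn
      (((hp.mul hg).sub (hφ.mul hk)).div (hg.pow 2) fun x hx => pow_ne_zero 2 (hg0 x hx)))
  have c3 : ContinuousOn (fun x => -Complex.I * Complex.exp (Complex.I * (h x : ℂ)) *
      ((φ x / g x : ℝ) : ℂ)) (Set.Icc a b) :=
    (continuousOn_const.mul hE).mul
      (Complex.continuous_ofReal.comp_continuousOn (hφ.div hg hg0))
  have i1 := c1.intervalIntegrable_of_Icc (μ := volume) hab
  have i2 := c2.intervalIntegrable_of_Icc (μ := volume) hab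
  rw [← sub_eq_iff_eq_add, ← intervalIntegral.integral_sub i1 i2]
  refine integral_eq_sub_of_hasDerivAt_of_le hab c3 (fun x hx => ?_) (i1.sub i2)
  have hgx := hg0 x (Set.Ioo_subset_Icc_self hx)
  have hgx' : (g x : ℂ) ≠ 0 := by exact_mod_cast hgx
  have hd := ((((hh' x hx).ofReal_comp.const_mul Complex.I).cexp).const_mul (-Complex.I)).mul
    ((hφ' x hx).div (hg' x hx) hgx).ofReal_comp
  refine hd.congr_deriv ?_
  simp only [Pi.div_apply]
  push_cast
  field_simp
  linear_combination (-(g x : ℂ) ^ 2 * φ x) * Complex.I_sq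

/-- first-derivative Van der Corput lemma with the monotonicity hypothesis
on `h'` replaced by the quantitative second-derivative bound `|h''| < B·A/(b-a)`. -/
theorem stmt13
    (a b A B : ℝ) (hab : a < b) (hA : 0 < A) (hB : 0 < B)
    (h φ : ℝ → ℝ)
    (hh : ContDiffOn ℝ 2 h (Set.Icc a b))
    (hφ : ContDiffOn ℝ 1 φ (Set.Icc a b))
    (hd1 : ∀ x ∈ Set.Icc a b, A < |derivWithin h (Set.Icc a b) x|)
    (hd2 : ∀ x ∈ Set.Icc a b,
      |derivWithin (derivWithin h (Set.Icc a b)) (Set.Icc a b) x| < B * A / (b - a)) :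
    ‖∫ x in a..b, Complex.exp (Complex.I * (h x : ℂ)) * (φ x : ℂ)‖ ≤
      A⁻¹ * ((B + 2) * sSup ((fun x => |φ x|) '' Set.Icc a b)
        + ∫ x in a..b, |derivWithin φ (Set.Icc a b) x|) := by
  have hu : UniqueDiffOn ℝ (Set.Icc a b) := uniqueDiffOn_Icc hab
  have hgC : ContDiffOn ℝ 1 (derivWithin h (Set.Icc a b)) (Set.Icc a b) :=
    hh.derivWithin hu (by norm_num)
  have hkC := hgC.continuousOn_derivWithin hu le_rfl
  have hpC := hφ.continuousOn_derivWithin hu le_rfl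
  have hasDeriv : ∀ f : ℝ → ℝ, ContDiffOn ℝ 1 f (Set.Icc a b) → ∀ x ∈ Set.Ioo a b,
      HasDerivAt f (derivWithin f (Set.Icc a b) x) x := fun f hf x hx =>
    ((hf.differentiableOn one_ne_zero) x
      (Set.Ioo_subset_Icc_self hx)).hasDerivWithinAt.hasDerivAt (Icc_mem_nhds hx.1 hx.2)
  have hh' := hasDeriv h (hh.of_le (by norm_num))
  have hg' := hasDeriv _ hgC
  have hφ' := hasDeriv φ hφ
  generalize derivWithin (derivWithin h (Set.Icc a b)) (Set.Icc a b) = k at *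
  have hgc := hgC.continuousOn
  generalize derivWithin h (Set.Icc a b) = g at *
  generalize derivWithin φ (Set.Icc a b) = p at *
  set M := sSup ((fun x => |φ x|) '' Set.Icc a b)
  have hM : ∀ x ∈ Set.Icc a b, |φ x| ≤ M := fun x hx =>
    le_csSup (isCompact_Icc.image_of_continuousOn hφ.continuousOn.abs).bddAbove
      (Set.mem_image_of_mem _ hx)
  have ha : a ∈ Set.Icc a b := Set.left_mem_Icc.2 hab.le
  have hb : b ∈ Set.Icc a b := Set.right_mem_Icc.2 hab.le
  have hM0 : 0 ≤ M := (abs_nonneg _).trans (hM a ha)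
  have hba : 0 < b - a := sub_pos.2 hab
  have hg0 : ∀ x ∈ Set.Icc a b, g x ≠ 0 := fun x hx => abs_pos.1 (hA.trans (hd1 x hx))
  have hexp : ∀ x, ‖Complex.exp (Complex.I * (h x : ℂ))‖ = 1 := fun x => by
    rw [mul_comm]; exact Complex.norm_exp_ofReal_mul_I _
  have hboundary : ∀ x ∈ Set.Icc a b,
      ‖-Complex.I * Complex.exp (Complex.I * (h x : ℂ)) * ((φ x / g x : ℝ) : ℂ)‖
        ≤ A⁻¹ * M := fun x hx => by
    rw [norm_mul, norm_mul, norm_neg, Complex.norm_I, hexp, Complex.norm_real, Real.norm_eq_abs,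
      abs_div, one_mul, one_mul, inv_mul_eq_div]
    exact div_le_div₀ hM0 (hM x hx) hA (hd1 x hx).le
  have hbulk : ∀ x ∈ Set.Icc a b, ‖Complex.I * Complex.exp (Complex.I * (h x : ℂ)) *
      (((p x * g x - φ x * k x) / g x ^ 2 : ℝ) : ℂ)‖ ≤ A⁻¹ * (|p x| + M * B / (b - a)) :=
    fun x hx => by
    rw [norm_mul, norm_mul, Complex.norm_I, hexp, Complex.norm_real, Real.norm_eq_abs,
      one_mul, one_mul]
    have hgx := hg0 x hx
    have hsplit : (p x * g x - φ x * k x) / g x ^ 2 = p x / g x - φ x * k x / g x ^ 2 := by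
      field_simp
    have h1 : |p x / g x| ≤ |p x| / A := by
      rw [abs_div]
      exact div_le_div_of_nonneg_left (abs_nonneg _) hA (hd1 x hx).le
    have h2 : |φ x * k x / g x ^ 2| ≤ M * (B * A / (b - a)) / A ^ 2 := by
      rw [abs_div, abs_mul, abs_pow]
      have := hM x hx
      have := (hd2 x hx).le
      have := (hd1 x hx).le
      gcongr
    calc _ ≤ |p x / g x| + |φ x * k x / g x ^ 2| := hsplit ▸ abs_sub _ _
      _ ≤ |p x| / A + M * (B * A / (b - a)) / A ^ 2 := add_le_add h1 h2
      _ = _ := by field_simp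
  have ip : IntervalIntegrable (fun x => |p x|) volume a b :=
    hpC.abs.intervalIntegrable_of_Icc hab.le
  rw [integral_exp_mul_eq_boundary_add_integral hab.le hh.continuousOn hgc hkC hφ.continuousOn
    hpC hh' hg' hφ' hg0]
  have hint := intervalIntegral.norm_integral_le_of_norm_le (μ := volume) hab.le
    (Filter.Eventually.of_forall fun x hx => hbulk x (Set.Ioc_subset_Icc_self hx))
    ((ip.add intervalIntegrable_const).const_mul _)
  rw [intervalIntegral.integral_const_mul, intervalIntegral.integral_add ip
    intervalIntegrable_const, intervalIntegral.integral_const, smul_eq_mul,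
    mul_div_cancel₀ _ hba.ne'] at hint
  refine (norm_add_le _ _).trans ((add_le_add ((norm_sub_le _ _).trans
    (add_le_add (hboundary b hb) (hboundary a ha))) hint).trans_eq ?_)
  ring
end

section
/- For every integer k ≥ 1 there is a constant B_k depending only on k such that the following holds: if I ⊆ ℝ is an interval, A > 0, and f : I → ℝ is a C^k function with |f^{(k)}(t)| > A for all t ∈ I, then for every ε > 0 one has m({t ∈ I : |f(t)| < ε}) ≤ B_k A^{−1/k} ε^{1/k}, where m is Lebesgue measure on ℝ. -/
open MeasureTheory

lemma exists_mem_sub_eq_mul_of_hasDerivWithinAt {I : Set ℝ} (hI : I.OrdConnected) {g g' : ℝ → ℝ}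
    (hg : ∀ t ∈ I, HasDerivWithinAt g (g' t) I t) {x y : ℝ} (hx : x ∈ I) (hy : y ∈ I)
    (hxy : x < y) : ∃ c ∈ I, g y - g x = g' c * (y - x) := by
  have hsub : Set.Icc x y ⊆ I := hI.out hx hy
  obtain ⟨c, hc, h⟩ := exists_hasDerivAt_eq_slope g g' hxy
    (fun t ht => (hg t (hsub ht)).continuousWithinAt.mono hsub)
    (fun t ht => (hg t (hsub (Set.Ioo_subset_Icc_self ht))).hasDerivAt
      (Filter.mem_of_superset (Icc_mem_nhds ht.1 ht.2) hsub))
  refine ⟨c, hsub (Set.Ioo_subset_Icc_self hc), ?_⟩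
  rw [h, div_mul_cancel₀ _ (sub_pos.2 hxy).ne']

lemma volume_abs_lt_le_of_le_abs_deriv {I : Set ℝ} (hI : I.OrdConnected) {g g' : ℝ → ℝ}
    (hg : ∀ t ∈ I, HasDerivWithinAt g (g' t) I t) {A δ : ℝ} (hA : 0 < A)
    (hg' : ∀ t ∈ I, A ≤ |g' t|) :
    volume {t ∈ I | |g t| < A * δ} ≤ ENNReal.ofReal (2 * δ) := by
  have key : ∀ x ∈ {t ∈ I | |g t| < A * δ}, ∀ y ∈ {t ∈ I | |g t| < A * δ}, x < y →
      y - x ≤ 2 * δ := by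
    rintro x ⟨hx, hgx⟩ y ⟨hy, hgy⟩ hxy
    obtain ⟨c, hc, h⟩ := exists_mem_sub_eq_mul_of_hasDerivWithinAt hI hg hx hy hxy
    have h1 : A * (y - x) ≤ |g y - g x| := by
      rw [h, abs_mul, abs_of_pos (sub_pos.2 hxy)]
      exact mul_le_mul_of_nonneg_right (hg' c hc) (sub_pos.2 hxy).le
    have h2 := abs_sub (g y) (g x)
    refine le_of_mul_le_mul_left ?_ hA
    linarith
  refine (Real.volume_le_diam _).trans (Metric.ediam_le fun x hx y hy => ?_)
  rw [edist_dist, Real.dist_eq]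
  refine ENNReal.ofReal_le_ofReal ?_
  rcases lt_trichotomy x y with h | rfl | h
  · rw [abs_sub_comm, abs_of_pos (sub_pos.2 h)]
    exact key x hx y hy h
  · have := (abs_nonneg _).trans_lt hx.2
    have : 0 < δ := pos_of_mul_pos_right this hA.le
    simp [this.le]
  · rw [abs_of_pos (sub_pos.2 h)]
    exact key y hy x hx h

lemma monotoneOn_or_antitoneOn_of_hasDerivWithinAt_ne_zero {I : Set ℝ} (hI : I.OrdConnected)
    {g g' : ℝ → ℝ} (hg : ∀ t ∈ I, HasDerivWithinAt g (g' t) I t) (hg' : ∀ t ∈ I, g' t ≠ 0) :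
    MonotoneOn g I ∨ AntitoneOn g I := by
  rcases hasDerivWithinAt_forall_lt_or_forall_gt_of_forall_ne hI.convex hg hg' with h | h
  · right
    intro x hx y hy hxy
    rcases hxy.eq_or_lt with rfl | hxy
    · rfl
    obtain ⟨c, hc, e⟩ := exists_mem_sub_eq_mul_of_hasDerivWithinAt hI hg hx hy hxy
    nlinarith [h c hc]
  · left
    intro x hx y hy hxy
    rcases hxy.eq_or_lt with rfl | hxy
    · rfl
    obtain ⟨c, hc, e⟩ := exists_mem_sub_eq_mul_of_hasDerivWithinAt hI hg hx hy hxy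
    nlinarith [h c hc]

lemma ordConnected_sep_le_and_sep_ge {I : Set ℝ} (hI : I.OrdConnected) {g : ℝ → ℝ}
    (hg : MonotoneOn g I ∨ AntitoneOn g I) (a b : ℝ) :
    {t ∈ I | g t ≤ a}.OrdConnected ∧ {t ∈ I | b ≤ g t}.OrdConnected := by
  constructor <;> refine ⟨fun x hx y hy z hz => ?_⟩ <;>
    have hzI := hI.out hx.1 hy.1 hz <;> refine ⟨hzI, ?_⟩ <;> rcases hg with hg | hg
  · exact (hg hzI hy.1 hz.2).trans hy.2
  · exact (hg hx.1 hzI hz.1).trans hx.2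
  · exact hx.2.trans (hg hx.1 hzI hz.1)
  · exact hy.2.trans (hg hzI hy.1 hz.2)

lemma volume_abs_lt_le_of_le_abs_iterated_deriv (k : ℕ) (F : ℕ → ℝ → ℝ) {δ : ℝ} (hδ : 0 < δ) :
    ∀ I : Set ℝ, I.OrdConnected →
      (∀ i < k, ∀ t ∈ I, HasDerivWithinAt (F i) (F (i + 1) t) I t) →
      ∀ A : ℝ, 0 < A → (∀ t ∈ I, A ≤ |F k t|) →
      volume {t ∈ I | |F 0 t| < A * δ ^ k} ≤ ENNReal.ofReal ((2 ^ (k + 1) - 2) * δ) := by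
  induction k with
  | zero =>
    intro I _ _ A _ hF
    have : {t ∈ I | |F 0 t| < A * δ ^ 0} = ∅ := by
      ext t
      simpa using hF t
    rw [this, measure_empty]
    exact zero_le
  | succ k ih =>
    intro I hI hder A hA hF
    have hk := hder k k.lt_succ_self
    obtain ⟨hlow, hhigh⟩ := ordConnected_sep_le_and_sep_ge hI
      (monotoneOn_or_antitoneOn_of_hasDerivWithinAt_ne_zero hI hk
        fun t ht => abs_pos.1 (hA.trans_le (hF t ht))) (-(A * δ)) (A * δ)
    have hsub : ∀ J ⊆ I, J.OrdConnected → (∀ t ∈ J, A * δ ≤ |F k t|) →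
        volume {t ∈ J | |F 0 t| < A * δ ^ (k + 1)} ≤
          ENNReal.ofReal ((2 ^ (k + 1) - 2) * δ) := by
      intro J hJI hJ hFJ
      rw [pow_succ', ← mul_assoc]
      exact ih J hJ (fun i hi t ht => (hder i (by omega) t (hJI ht)).mono hJI) _
        (mul_pos hA hδ) hFJ
    have hcover : {t ∈ I | |F 0 t| < A * δ ^ (k + 1)} ⊆
        {t ∈ I | |F k t| < A * δ} ∪
          ({t ∈ {t ∈ I | F k t ≤ -(A * δ)} | |F 0 t| < A * δ ^ (k + 1)} ∪
            {t ∈ {t ∈ I | A * δ ≤ F k t} | |F 0 t| < A * δ ^ (k + 1)}) := by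
      rintro t ⟨ht, ht0⟩
      rcases lt_or_ge |F k t| (A * δ) with h | h
      · exact Or.inl ⟨ht, h⟩
      · rcases le_abs'.1 h with h | h
        · exact Or.inr (Or.inl ⟨⟨ht, h⟩, ht0⟩)
        · exact Or.inr (Or.inr ⟨⟨ht, h⟩, ht0⟩)
    have hpow : (0 : ℝ) ≤ (2 ^ (k + 1) - 2) * δ := by
      have : (1 : ℝ) ≤ 2 ^ k := one_le_pow₀ one_le_two
      exact mul_nonneg (by rw [pow_succ]; linarith) hδ.le
    calc volume {t ∈ I | |F 0 t| < A * δ ^ (k + 1)}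
        ≤ ENNReal.ofReal (2 * δ) + (ENNReal.ofReal ((2 ^ (k + 1) - 2) * δ) +
            ENNReal.ofReal ((2 ^ (k + 1) - 2) * δ)) :=
          (measure_mono hcover).trans <| (measure_union_le _ _).trans <|
            add_le_add (volume_abs_lt_le_of_le_abs_deriv hI hk hA hF) <|
            (measure_union_le _ _).trans <| add_le_add
              (hsub _ (Set.sep_subset _ _) hlow fun t ht => le_abs'.2 (Or.inl ht.2))
              (hsub _ (Set.sep_subset _ _) hhigh fun t ht => le_abs'.2 (Or.inr ht.2))
      _ = ENNReal.ofReal ((2 ^ (k + 1 + 1) - 2) * δ) := by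
          rw [← ENNReal.ofReal_add hpow hpow, ← ENNReal.ofReal_add (by positivity) (by positivity)]
          ring_nf

lemma Set.OrdConnected.uniqueDiffOn_of_nontrivial {I : Set ℝ} (hI : I.OrdConnected)
    (h : I.Nontrivial) : UniqueDiffOn ℝ I := by
  obtain ⟨x, hx, y, hy, hxy⟩ := h.exists_lt
  refine uniqueDiffOn_convex hI.convex ?_
  exact (Set.nonempty_Ioo.2 hxy).mono
    (interior_maximal (Set.Ioo_subset_Icc_self.trans (hI.out hx hy)) isOpen_Ioo)

/-- the measure (sublevel-set) version of the Van der Corput lemma: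
if `|f^{(k)}| > A` on an interval `I`, then `m({t ∈ I : |f t| < ε}) ≤ B_k A^{-1/k} ε^{1/k}`. -/
theorem stmt14 (k : ℕ) (hk : 1 ≤ k) :
    ∃ B : ℝ, 0 < B ∧
      ∀ I : Set ℝ, I.OrdConnected →
        ∀ A : ℝ, 0 < A →
          ∀ f : ℝ → ℝ, ContDiffOn ℝ k f I →
            (∀ t ∈ I, A < |iteratedDerivWithin k f I t|) →
            ∀ ε : ℝ, 0 < ε →
              volume {t ∈ I | |f t| < ε}
                ≤ ENNReal.ofReal (B * A ^ (-(1 : ℝ) / k) * ε ^ ((1 : ℝ) / k)) := by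
  refine ⟨2 ^ (k + 1) - 2, ?_, fun I hI A hA f hf hfk ε hε => ?_⟩
  · have : (2 : ℝ) ≤ 2 ^ k := le_self_pow₀ one_le_two (by omega)
    rw [pow_succ]
    linarith
  rcases I.subsingleton_or_nontrivial with hs | hn
  · rw [(hs.anti (Set.sep_subset _ _)).measure_zero]
    exact zero_le
  have hu := hI.uniqueDiffOn_of_nontrivial hn
  have hder : ∀ i < k, ∀ t ∈ I, HasDerivWithinAt (iteratedDerivWithin i f I)
      (iteratedDerivWithin (i + 1) f I t) I t := by
    intro i hi t ht
    rw [iteratedDerivWithin_succ]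
    exact (hf.differentiableOn_iteratedDerivWithin (by exact_mod_cast hi) hu t ht).hasDerivWithinAt
  have hk0 : (k : ℝ) ≠ 0 := by positivity
  have hscale : A * ((ε / A) ^ ((1 : ℝ) / k)) ^ k = ε := by
    rw [one_div, Real.rpow_inv_natCast_pow (by positivity) (by omega), mul_div_cancel₀ _ hA.ne']
  have h := volume_abs_lt_le_of_le_abs_iterated_deriv k (fun i => iteratedDerivWithin i f I)
    (Real.rpow_pos_of_pos (div_pos hε hA) ((1 : ℝ) / k)) I hI hder A hA fun t ht => (hfk t ht).le
  simp only [hscale, iteratedDerivWithin_zero] at h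
  rwa [Real.div_rpow hε.le hA.le, div_eq_inv_mul, ← Real.rpow_neg hA.le, ← neg_div,
    ← mul_assoc] at h
end

section
/- Let n ≥ 1. Suppose that for each (n+1)-tuple (v₁,…,v_{n+1}) of mutually orthogonal unit vectors in ℝ^{n+1} a number ε(v₁,…,v_{n+1}) > 0 is given, and define B_{v₁,…,v_{n+1}} = { c₁v₁ + ⋯ + c_{n+1}v_{n+1} : |c₁| ≤ 1 and |c_{i+1}| ≤ ε(v₁,…,v_{n+1})·|c_i| for all 1 ≤ i ≤ n }. Then there is a finite collection B₁,…,B_N of such sets (each B_j being B_{v₁,…,v_{n+1}} for some tuple of mutually orthogonal unit vectors) whose union contains the closed unit ball {x ∈ ℝ^{n+1} : |x| ≤ 1}. -/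
open MeasureTheory

/-- Along an ultrafilter on a nontrivial finite-dimensional inner product space, the directions
`x / ‖x‖` converge to a unit vector `w`, so the component of `x` orthogonal to `w` is eventually
negligible compared to the component along `w`. -/
lemma exists_unit_eventually_norm_orthogonalProjectionOnto_le {V : Type*} [NormedAddCommGroup V]
    [InnerProductSpace ℝ V] [FiniteDimensional ℝ V] [Nontrivial V] (U : Ultrafilter V) :
    ∃ w : V, ‖w‖ = 1 ∧ ∀ ε : ℝ, 0 < ε → ∀ᶠ x in (U : Filter V),
      ‖(ℝ ∙ w)ᗮ.orthogonalProjectionOnto x‖ ≤ ε * |inner ℝ w x| := by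
  classical
  obtain ⟨e, he⟩ := exists_norm_eq V zero_le_one
  let f : V → V := fun x => if x = 0 then e else ‖x‖⁻¹ • x
  have hf : ∀ x, f x ∈ Metric.sphere (0 : V) 1 := by
    intro x
    by_cases hx : x = 0
    · simp [f, hx, he]
    · simp [f, hx, norm_smul]
  have hfx : ∀ x, x = ‖x‖ • f x := by
    intro x
    by_cases hx : x = 0
    · simp [hx]
    · simp [f, hx, smul_smul]
  obtain ⟨w, hw, hUw⟩ := (isCompact_sphere (0 : V) 1).ultrafilter_le_nhds (U.map f)
    (Filter.le_principal_iff.2 (Filter.mem_map.2 (Filter.univ_mem' hf)))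
  have hw1 : ‖w‖ = 1 := by simpa using hw
  have hlim : Filter.Tendsto f U (nhds w) := hUw
  refine ⟨w, hw1, fun ε hε => ?_⟩
  have hPw : (ℝ ∙ w)ᗮ.orthogonalProjectionOnto w = 0 :=
    Submodule.orthogonalProjectionOnto_orthogonalComplement_singleton_eq_zero w
  have hP : Filter.Tendsto (fun x => ‖(ℝ ∙ w)ᗮ.orthogonalProjectionOnto (f x)‖) U (nhds 0) := by
    have := (((ℝ ∙ w)ᗮ.orthogonalProjectionOnto.continuous.tendsto w).comp hlim).norm
    simpa [hPw] using this
  have hI : Filter.Tendsto (fun x => ε * |inner ℝ w (f x)|) U (nhds ε) := by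
    have hc : Continuous fun y : V => ε * |inner ℝ w y| := by fun_prop
    simpa [hw1, Function.comp_def] using (hc.tendsto w).comp hlim
  filter_upwards [hP.eventually_lt hI hε] with x hx
  rw [hfx x, map_smul, norm_smul, inner_smul_right, abs_mul, norm_norm, abs_norm]
  calc ‖x‖ * ‖(ℝ ∙ w)ᗮ.orthogonalProjectionOnto (f x)‖ ≤ ‖x‖ * (ε * |inner ℝ w (f x)|) := by gcongr
    _ = ε * (‖x‖ * |inner ℝ w (f x)|) := by ring

/-- Every ultrafilter on a finite-dimensional inner product space has an orthonormal frame along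
which each coordinate is eventually negligible compared to the previous one. -/
lemma exists_orthonormal_eventually_abs_inner_le (d : ℕ) :
    ∀ {V : Type*} [NormedAddCommGroup V] [InnerProductSpace ℝ V] [FiniteDimensional ℝ V],
      Module.finrank ℝ V = d → ∀ U : Ultrafilter V, ∃ v : Fin d → V, Orthonormal ℝ v ∧
        ∀ ε : ℝ, 0 < ε → ∀ᶠ x in (U : Filter V), ∀ i j : Fin d, (i : ℕ) + 1 = j →
          |inner ℝ (v j) x| ≤ ε * |inner ℝ (v i) x| := by
  induction d with
  | zero =>
    intro V _ _ _ _ U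
    exact ⟨Fin.elim0, ⟨fun i => i.elim0, fun i => i.elim0⟩,
      fun ε _ => Filter.Eventually.of_forall fun x i => i.elim0⟩
  | succ d ih =>
    intro V _ _ _ hd U
    have : Nontrivial V := Module.nontrivial_of_finrank_pos (R := ℝ) (by omega)
    obtain ⟨w, hw, hUw⟩ := exists_unit_eventually_norm_orthogonalProjectionOnto_le U
    have : Fact (Module.finrank ℝ V = d + 1) := ⟨hd⟩
    have hw0 : w ≠ 0 := norm_ne_zero_iff.1 (by simp [hw])
    have hdim : Module.finrank ℝ (ℝ ∙ w)ᗮ = d :=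
      Submodule.finrank_orthogonal_span_singleton hw0
    obtain ⟨v, hv, hUv⟩ := ih hdim (U.map (ℝ ∙ w)ᗮ.orthogonalProjectionOnto)
    have hin : ∀ k (x : V),
        inner ℝ ((v k : (ℝ ∙ w)ᗮ) : V) x = inner ℝ (v k) ((ℝ ∙ w)ᗮ.orthogonalProjectionOnto x) :=
      fun k x => (Submodule.inner_orthogonalProjectionOnto_eq_of_mem_left (v k) x).symm
    have hperp : ∀ k, inner ℝ w ((v k : (ℝ ∙ w)ᗮ) : V) = 0 := fun k =>
      Submodule.mem_orthogonal_singleton_iff_inner_right.1 (v k).2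
    refine ⟨Fin.cons w fun k => ((v k : (ℝ ∙ w)ᗮ) : V), ⟨?_, ?_⟩, fun ε hε => ?_⟩
    · intro i
      cases i using Fin.cases with
      | zero => simpa using hw
      | succ k => simpa using hv.1 k
    · intro i j hij
      cases i using Fin.cases with
      | zero =>
        cases j using Fin.cases with
        | zero => exact absurd rfl hij
        | succ l => simpa using hperp l
      | succ k =>
        cases j using Fin.cases with
        | zero => simpa [real_inner_comm] using hperp k
        | succ l => simpa using hv.2 (fun h => hij (congrArg Fin.succ h))
    · have hv' := hUv ε hε
      rw [Ultrafilter.coe_map, Filter.eventually_map] at hv'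
      filter_upwards [hUw ε hε, hv'] with x hx hx' i j hij
      cases j using Fin.cases with
      | zero => simp at hij
      | succ l =>
        cases i using Fin.cases with
        | zero =>
          simp only [Fin.cons_succ, Fin.cons_zero, hin]
          refine le_trans ?_ hx
          simpa [hv.1 l] using
            abs_real_inner_le_norm (v l) ((ℝ ∙ w)ᗮ.orthogonalProjectionOnto x)
        | succ k =>
          simp only [Fin.cons_succ, hin]
          exact hx' k l (by simpa using hij)

/-- A set `K` is covered by finitely many members of a family as soon as every ultrafilter
containing `K` contains a member of the family. -/
lemma exists_finite_cover_of_ultrafilter {α ι : Type*} {K : Set α} {B : ι → Set α}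
    (h : ∀ U : Ultrafilter α, K ∈ U → ∃ i, B i ∈ U) :
    ∃ t : Set ι, t.Finite ∧ K ⊆ ⋃ i ∈ t, B i := by
  have hK : Kᶜ ∈ ⨅ i, Filter.principal (B i)ᶜ := by
    rw [Filter.mem_iff_ultrafilter]
    intro U hU
    rw [Ultrafilter.compl_mem_iff_notMem]
    intro hKU
    obtain ⟨i, hi⟩ := h U hKU
    have hi' : (B i)ᶜ ∈ U := Filter.le_principal_iff.1 (hU.trans (iInf_le _ i))
    exact Ultrafilter.compl_mem_iff_notMem.1 hi' hi
  obtain ⟨t, ht, htK⟩ := (Filter.hasBasis_iInf_principal_finite _).mem_iff.1 hK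
  refine ⟨t, ht, ?_⟩
  rw [← Set.compl_subset_compl]
  simpa only [Set.compl_iUnion] using htK

/-- compactness lemma: the closed unit ball of `ℝ^{n+1}` is covered by
finitely many cone-like sets `B_{v₁,…,v_{n+1}}` adapted to orthonormal frames, where each
frame `v` is given its own parameter `ε v > 0`. -/
theorem stmt15
    (n : ℕ) (hn : 1 ≤ n)
    (ε : (Fin (n + 1) → EuclideanSpace ℝ (Fin (n + 1))) → ℝ)
    (hε : ∀ v : Fin (n + 1) → EuclideanSpace ℝ (Fin (n + 1)), Orthonormal ℝ v → 0 < ε v) :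
    ∃ (N : ℕ) (v : Fin N → Fin (n + 1) → EuclideanSpace ℝ (Fin (n + 1))),
      (∀ j, Orthonormal ℝ (v j)) ∧
      Metric.closedBall (0 : EuclideanSpace ℝ (Fin (n + 1))) 1 ⊆
        ⋃ j, {x : EuclideanSpace ℝ (Fin (n + 1)) |
          ∃ c : Fin (n + 1) → ℝ, x = ∑ i, c i • v j i ∧ |c 0| ≤ 1 ∧
            ∀ i : Fin n, |c i.succ| ≤ ε (v j) * |c i.castSucc|} := by
  let B : {v : Fin (n + 1) → EuclideanSpace ℝ (Fin (n + 1)) // Orthonormal ℝ v} →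
      Set (EuclideanSpace ℝ (Fin (n + 1))) := fun v =>
    {x | ∃ c : Fin (n + 1) → ℝ, x = ∑ i, c i • v.1 i ∧ |c 0| ≤ 1 ∧
      ∀ i : Fin n, |c i.succ| ≤ ε v.1 * |c i.castSucc|}
  obtain ⟨t, ht, hcover⟩ := exists_finite_cover_of_ultrafilter
    (K := Metric.closedBall (0 : EuclideanSpace ℝ (Fin (n + 1))) 1) (B := B) (by
      intro U hU
      obtain ⟨v, hv, hUv⟩ :=
        exists_orthonormal_eventually_abs_inner_le (n + 1) finrank_euclideanSpace_fin U
      refine ⟨⟨v, hv⟩, ?_⟩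
      filter_upwards [hU, hUv (ε v) (hε v hv)] with x hx hxv
      have hspan : ⊤ ≤ Submodule.span ℝ (Set.range v) :=
        (hv.linearIndependent.span_eq_top_of_card_eq_finrank' (by simp)).ge
      refine ⟨fun i => inner ℝ (v i) x, ?_, ?_, fun i => hxv _ _ (by simp)⟩
      · simpa using ((OrthonormalBasis.mk hv hspan).sum_repr' x).symm
      · have hx1 : ‖x‖ ≤ 1 := by simpa using hx
        refine (abs_real_inner_le_norm (v 0) x).trans ?_
        simpa [hv.1 0] using hx1)
  have := ht.fintype
  refine ⟨Fintype.card t, fun j => ((Fintype.equivFin t).symm j).1.1,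
    fun j => ((Fintype.equivFin t).symm j).1.2, fun x hx => ?_⟩
  obtain ⟨v, hvt, hxv⟩ := Set.mem_iUnion₂.1 (hcover hx)
  refine Set.mem_iUnion.2 ⟨Fintype.equivFin t ⟨v, hvt⟩, ?_⟩
  simpa [B] using hxv
end

section
/- Let φ₀ : ℝⁿ → ℝ be a smooth, compactly supported, nonnegative function, and let f : ℝⁿ → ℝ be real analytic on a neighborhood of the support of φ₀ and not identically zero there. Suppose that for some 0 < g' ≤ 1 and C > 0 one has |∫_{ℝⁿ} φ₀(x) e^{−i λ f(x)} dx| ≤ C (1 + |λ|)^{−g'} for all λ ∈ ℝ. Then for every 0 < g'' < g' the integral ∫_{ℝⁿ} |f(x)|^{−g''} φ₀(x) dx is finite. Consequently, if φ₀ ≥ c > 0 on a neighborhood N of some point, then there is a constant C' with m({x ∈ N : |f(x)| < ε}) ≤ C' ε^{g''} for all ε > 0 (m being Lebesgue measure on ℝⁿ). -/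
open MeasureTheory Filter Topology Complex

/-- `|t|^s e^{-bt²}` is integrable on the whole line for `s > -1`. -/
theorem integrable_abs_rpow_mul_exp_neg_mul_sq {b s : ℝ} (hb : 0 < b) (hs : -1 < s) :
    Integrable (fun t : ℝ => |t| ^ s * Real.exp (-b * |t| ^ 2)) := by
  have hpos : IntegrableOn (fun t : ℝ => |t| ^ s * Real.exp (-b * |t| ^ 2)) (Set.Ioi 0) :=
    (integrableOn_rpow_mul_exp_neg_mul_sq hb hs).congr_fun
      (fun t ht => by simp only [abs_of_pos (Set.mem_Ioi.1 ht)]) measurableSet_Ioi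
  rw [← integrableOn_univ, ← Set.Iic_union_Ioi (a := (0 : ℝ)), integrableOn_union]
  refine ⟨?_, hpos⟩
  rw [integrableOn_Iic_iff_integrableOn_Iio,
    ← (Measure.measurePreserving_neg (volume : Measure ℝ)).integrableOn_comp_preimage
      (Homeomorph.neg ℝ).measurableEmbedding]
  simpa [Function.comp_def] using hpos

/-- Parseval's identity for a Gaussian against a finite measure on the line. -/
theorem integral_gaussian_mul_charFun (ν : Measure ℝ) [IsFiniteMeasure ν] {b : ℝ} (hb : 0 < b) :
    ∫ t : ℝ, Complex.exp (-b * t ^ 2) * charFun ν t =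
      ((√(Real.pi / b) * ∫ x, Real.exp (-x ^ 2 / (4 * b)) ∂ν : ℝ) : ℂ) := by
  have hb' : 0 < (b : ℂ).re := by simpa using hb
  have hint : Integrable (Function.uncurry fun t x : ℝ =>
      Complex.exp (-b * t ^ 2) * Complex.exp (t * x * I)) ((volume : Measure ℝ).prod ν) := by
    refine ((integrable_cexp_neg_mul_sq hb').comp_fst ν).mono
      (by unfold Function.uncurry; fun_prop) (ae_of_all _ fun p => ?_)
    have h : ‖Complex.exp (p.1 * p.2 * I)‖ = 1 := by
      exact_mod_cast Complex.norm_exp_ofReal_mul_I (p.1 * p.2)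
    simp [Function.uncurry, h]
  simp_rw [charFun_apply_real, ← integral_const_mul]
  rw [integral_integral_swap hint, ← integral_complex_ofReal]
  congr 1
  ext x
  have h := fourierIntegral_gaussian hb' (x : ℂ)
  have hsqrt : ((√(Real.pi / b) : ℝ) : ℂ) = (Real.pi / b : ℂ) ^ (1 / 2 : ℂ) := by
    rw [Real.sqrt_eq_rpow, Complex.ofReal_cpow (by positivity)]
    push_cast
    rfl
  push_cast
  rw [hsqrt]
  rw [← h]
  congr 1
  ext t
  rw [mul_comm]
  congr 2
  ring

/-- Decay `|t|^{-s}`, `s < 1`, of the characteristic function of a finite measure on the line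
bounds the mass of the interval `(-ε, ε)` by a multiple of `ε^s`. -/
theorem exists_measure_abs_lt_le_of_charFun_decay (ν : Measure ℝ) [IsFiniteMeasure ν] {C s : ℝ}
    (hC : 0 < C) (hs : s < 1) (hdecay : ∀ t ≠ 0, ‖charFun ν t‖ ≤ C * |t| ^ (-s)) :
    ∃ A : ℝ, 0 < A ∧ ∀ ε : ℝ, 0 < ε → ν {x | |x| < ε} ≤ ENNReal.ofReal (A * ε ^ s) := by
  have hΓ : 0 < Real.Gamma ((1 - s) / 2) := Real.Gamma_pos_of_pos (by linarith)
  refine ⟨C * Real.Gamma ((1 - s) / 2) / (√Real.pi * Real.exp (-1 / 4)), by positivity,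
    fun ε hε => ?_⟩
  have hb : 0 < ε ^ 2 := by positivity
  have hupper : ‖∫ t : ℝ, Complex.exp (-(ε ^ 2 : ℝ) * t ^ 2) * charFun ν t‖ ≤
      ∫ t : ℝ, C * (|t| ^ (-s) * Real.exp (-ε ^ 2 * |t| ^ 2)) := by
    refine norm_integral_le_of_norm_le
      ((integrable_abs_rpow_mul_exp_neg_mul_sq hb (by linarith)).const_mul C) ?_
    filter_upwards [Measure.ae_ne volume (0 : ℝ)] with t ht
    have hexp : ‖Complex.exp (-(ε ^ 2 : ℝ) * t ^ 2)‖ = Real.exp (-ε ^ 2 * |t| ^ 2) := by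
      rw [Complex.norm_exp, sq_abs]
      congr 1
      norm_cast
    rw [norm_mul, hexp]
    calc _ ≤ Real.exp (-ε ^ 2 * |t| ^ 2) * (C * |t| ^ (-s)) := by gcongr; exact hdecay t ht
      _ = _ := by ring
  have hvalue : ∫ t : ℝ, C * (|t| ^ (-s) * Real.exp (-ε ^ 2 * |t| ^ 2)) =
      C * (ε ^ (s - 1) * Real.Gamma ((1 - s) / 2)) := by
    have h := _root_.integral_rpow_mul_exp_neg_mul_rpow (p := 2) (q := -s) (b := ε ^ 2)
      (by norm_num) (by linarith) hb
    have hpow : (ε ^ 2) ^ (-(-s + 1) / 2) = ε ^ (s - 1) := by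
      rw [← Real.rpow_natCast, ← Real.rpow_mul hε.le]
      congr 1
      push_cast
      ring
    simp only [Real.rpow_ofNat] at h
    rw [integral_const_mul,
      integral_comp_abs (f := fun t => t ^ (-s) * Real.exp (-ε ^ 2 * t ^ 2)), h, hpow]
    rw [neg_add_eq_sub]
    ring
  have hsqrt : √(Real.pi / ε ^ 2) = √Real.pi / ε := by
    rw [Real.sqrt_div Real.pi_pos.le, Real.sqrt_sq hε.le]
  have hgauss : Integrable (fun x : ℝ => Real.exp (-x ^ 2 / (4 * ε ^ 2))) ν := by
    refine (integrable_const (1 : ℝ)).mono' (by fun_prop) (ae_of_all _ fun x => ?_)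
    rw [Real.norm_eq_abs, Real.abs_exp, Real.exp_le_one_iff, neg_div]
    exact neg_nonpos.2 (by positivity)
  have hmarkov : Real.exp (-1 / 4) * ν.real {x | |x| < ε} ≤
      ∫ x, Real.exp (-x ^ 2 / (4 * ε ^ 2)) ∂ν := by
    refine le_trans ?_ (mul_meas_ge_le_integral_of_nonneg
      (ae_of_all _ fun x => (Real.exp_pos _).le) hgauss (Real.exp (-1 / 4)))
    refine mul_le_mul_of_nonneg_left (measureReal_mono fun x (hx : |x| < ε) => ?_) (by positivity)
    have hx2 : x ^ 2 ≤ ε ^ 2 := by rw [← sq_abs]; gcongr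
    refine Real.exp_le_exp.2 ?_
    rw [div_le_div_iff₀ (by norm_num) (by positivity)]
    linarith
  rw [integral_gaussian_mul_charFun ν hb, hvalue, hsqrt, norm_real, Real.norm_of_nonneg
    (mul_nonneg (by positivity) (integral_nonneg fun x => (Real.exp_pos _).le))] at hupper
  have hmain : √Real.pi / ε * (Real.exp (-1 / 4) * ν.real {x | |x| < ε}) ≤
      C * (ε ^ (s - 1) * Real.Gamma ((1 - s) / 2)) :=
    (mul_le_mul_of_nonneg_left hmarkov (by positivity)).trans hupper
  rw [← ofReal_measureReal]
  refine ENNReal.ofReal_le_ofReal ?_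
  rw [Real.rpow_sub_one hε.ne'] at hmain
  rw [div_mul_eq_mul_div, le_div_iff₀ (by positivity)]
  have h := mul_le_mul_of_nonneg_right hmain hε.le
  field_simp at h
  linarith

/-- A finite measure on the line giving mass `O(ε^s)` to `(-ε, ε)` integrates `|x|^{-r}` for
every `0 < r < s`. -/
theorem lintegral_abs_rpow_neg_lt_top (ν : Measure ℝ) [IsFiniteMeasure ν] {A r s : ℝ}
    (hr : 0 < r) (hrs : r < s)
    (hν : ∀ ε : ℝ, 0 < ε → ν {x | |x| < ε} ≤ ENNReal.ofReal (A * ε ^ s)) :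
    ∫⁻ x, ENNReal.ofReal (|x| ^ (-r)) ∂ν < ⊤ := by
  rw [lintegral_eq_lintegral_meas_lt ν (ae_of_all _ fun x => by positivity) (by fun_prop),
    ← Set.Ioc_union_Ioi_eq_Ioi zero_le_one]
  refine (lintegral_union_le _ _ _).trans_lt (ENNReal.add_lt_top.2 ⟨?_, ?_⟩)
  · refine (setLIntegral_mono measurable_const fun t _ => measure_mono (Set.subset_univ _)).trans_lt
      ?_
    rw [setLIntegral_const]
    exact ENNReal.mul_lt_top (measure_lt_top _ _) (by simp)
  · have hint : IntegrableOn (fun t : ℝ => A * t ^ (-(s / r))) (Set.Ioi 1) :=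
      (integrableOn_Ioi_rpow_of_lt (by rw [neg_lt_neg_iff]; exact (one_lt_div hr).2 hrs)
        one_pos).const_mul A
    refine (setLIntegral_mono' measurableSet_Ioi fun t ht => ?_).trans_lt hint.setLIntegral_lt_top
    have ht0 : 0 < t := one_pos.trans ht
    have hpow : (t ^ (-r⁻¹)) ^ s = t ^ (-(s / r)) := by
      rw [← Real.rpow_mul ht0.le]
      congr 1
      ring
    rw [← hpow]
    refine (measure_mono fun x (hx : t < |x| ^ (-r)) => ?_).trans (hν _ (by positivity))
    have hx0 : 0 < |x| := by
      refine (abs_nonneg x).lt_of_ne fun h => ?_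
      rw [← h, Real.zero_rpow (by linarith)] at hx
      linarith
    have h := Real.rpow_lt_rpow_of_neg ht0 hx (neg_lt_zero.2 (inv_pos.2 hr))
    rwa [← Real.rpow_mul hx0.le, neg_mul_neg, mul_inv_cancel₀ hr.ne', Real.rpow_one] at h

/-- a uniform decay rate `(1+|λ|)^{-g'}` for the oscillatory integral
`∫ φ₀ e^{-iλf}` forces local integrability of `|f|^{-g''} φ₀` for every `g'' < g'`, and
hence the sublevel measure bound `m({x ∈ N : |f x| < ε}) ≤ C' ε^{g''}` wherever
`φ₀ ≥ c > 0`. -/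
theorem stmt16
    (n : ℕ) (hn : 1 ≤ n)
    (φ₀ : EuclideanSpace ℝ (Fin n) → ℝ)
    (hφs : ContDiff ℝ (⊤ : ℕ∞) φ₀) (hφc : HasCompactSupport φ₀) (hφnn : ∀ x, 0 ≤ φ₀ x)
    (f : EuclideanSpace ℝ (Fin n) → ℝ)
    (U : Set (EuclideanSpace ℝ (Fin n))) (hUo : IsOpen U) (hUs : tsupport φ₀ ⊆ U)
    (hfa : AnalyticOnNhd ℝ f U) (hfne : ∃ x ∈ U, f x ≠ 0)
    (g' C : ℝ) (hg'0 : 0 < g') (hg'1 : g' ≤ 1) (hC : 0 < C)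
    (hdecay : ∀ lam : ℝ,
      ‖∫ x : EuclideanSpace ℝ (Fin n),
          (φ₀ x : ℂ) * Complex.exp (-(Complex.I) * ((lam * f x : ℝ) : ℂ))‖
        ≤ C * (1 + |lam|) ^ (-g')) :
    ∀ g'' : ℝ, 0 < g'' → g'' < g' →
      (∫⁻ x : EuclideanSpace ℝ (Fin n), ENNReal.ofReal (|f x| ^ (-g'') * φ₀ x)) < ⊤ ∧
      ∀ (c : ℝ) (N : Set (EuclideanSpace ℝ (Fin n))),
        0 < c → (∃ x₀, N ∈ 𝓝 x₀) → (∀ x ∈ N, c ≤ φ₀ x) →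
        ∃ C' : ℝ, 0 < C' ∧
          ∀ ε : ℝ, 0 < ε →
            volume {x ∈ N | |f x| < ε} ≤ ENNReal.ofReal (C' * ε ^ g'') := by
  have hφcont : Continuous φ₀ := hφs.continuous
  set μ : Measure (EuclideanSpace ℝ (Fin n)) :=
    volume.withDensity fun x => ENNReal.ofReal (φ₀ x) with hμ
  have hφm : Measurable fun x => ENNReal.ofReal (φ₀ x) := by fun_prop
  have : IsFiniteMeasure μ :=
    isFiniteMeasure_withDensity_ofReal (hφcont.integrable_of_hasCompactSupport hφc).2
  classical
  have hfm : AEMeasurable f μ := by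
    have hcont : ContinuousOn f (tsupport φ₀) := hfa.continuousOn.mono hUs
    have hmeas : Measurable ((tsupport φ₀).piecewise f 0) :=
      hcont.measurable_piecewise continuousOn_const (isClosed_tsupport φ₀).measurableSet
    refine ⟨_, hmeas, (ae_withDensity_iff hφm).2 (ae_of_all _ fun x hx => ?_)⟩
    rw [Set.piecewise_eq_of_mem]
    refine subset_tsupport φ₀ fun h => hx ?_
    simp [h]
  have hchar : ∀ t : ℝ, charFun (μ.map f) t =
      ∫ x, (φ₀ x : ℂ) * Complex.exp (-I * ((-t * f x : ℝ) : ℂ)) := fun t => by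
    rw [charFun_apply_real, integral_map hfm (by fun_prop), hμ,
      integral_withDensity_eq_integral_toReal_smul hφm (by simp)]
    congr 1
    ext x
    rw [ENNReal.toReal_ofReal (hφnn x), real_smul]
    congr 2
    push_cast
    ring
  have hbound : ∀ s, 0 < s → s < g' → ∃ A : ℝ, 0 < A ∧ ∀ ε : ℝ, 0 < ε →
      μ.map f {x | |x| < ε} ≤ ENNReal.ofReal (A * ε ^ s) := fun s hs hsg => by
    refine exists_measure_abs_lt_le_of_charFun_decay (μ.map f) hC (hsg.trans_le hg'1)
      fun t ht => ?_
    have ht0 : 0 < |t| := abs_pos.2 ht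
    rw [hchar]
    refine (hdecay (-t)).trans ?_
    rw [abs_neg]
    gcongr C * ?_
    calc (1 + |t|) ^ (-g') ≤ (1 + |t|) ^ (-s) :=
          Real.rpow_le_rpow_of_exponent_le (by linarith) (by linarith)
      _ ≤ |t| ^ (-s) := Real.rpow_le_rpow_of_nonpos ht0 (by linarith) (by linarith)
  intro g'' hg0 hgg
  constructor
  · obtain ⟨s, hgs, hsg⟩ := exists_between hgg
    obtain ⟨A, -, hA⟩ := hbound s (hg0.trans hgs) hsg
    have h := lintegral_abs_rpow_neg_lt_top (μ.map f) hg0 hgs hA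
    rw [lintegral_map' (by fun_prop) hfm, hμ, lintegral_withDensity_eq_lintegral_mul₀' (by fun_prop)
      (by rw [← hμ]; fun_prop)] at h
    refine lt_of_eq_of_lt (lintegral_congr fun x => ?_) h
    rw [Pi.mul_apply, mul_comm, ENNReal.ofReal_mul (hφnn x)]
  · rintro c N hc - hN
    obtain ⟨A, hA0, hA⟩ := hbound g'' hg0 hgg
    refine ⟨A / c, by positivity, fun ε hε => ?_⟩
    have hset : ENNReal.ofReal c * volume {x ∈ N | |f x| < ε} ≤ μ.map f {x | |x| < ε} := by
      rw [← setLIntegral_const]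
      calc _ ≤ ∫⁻ x in {x ∈ N | |f x| < ε}, ENNReal.ofReal (φ₀ x) := by
            refine lintegral_mono_ae (ae_restrict_of_ae_restrict_of_subset
              (fun x hx => hN x hx.1) ((ae_restrict_iff' (isClosed_le continuous_const
                hφcont).measurableSet).2 (ae_of_all _ fun x hx => ?_)))
            exact ENNReal.ofReal_le_ofReal hx
        _ = μ {x ∈ N | |f x| < ε} := (withDensity_apply' _ _).symm
        _ ≤ μ (f ⁻¹' {x | |x| < ε}) := measure_mono fun x hx => hx.2
        _ ≤ _ := Measure.le_map_apply hfm _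
    rw [div_mul_eq_mul_div, ENNReal.ofReal_div_of_pos hc, ENNReal.le_div_iff_mul_le
      (Or.inl (ENNReal.ofReal_pos.2 hc).ne') (Or.inl ENNReal.ofReal_ne_top), mul_comm]
    exact hset.trans (hA ε hε)
end

section
/- Let K ≥ 1 and let σ₁,…,σ_K be distinct positive integers. Then there exists η > 0 depending only on σ₁,…,σ_K such that for all real coefficients c₁,…,c_K and every y ∈ ℝ with y ≠ 0, there is some p with 1 ≤ p ≤ K such that the function h(y) = Σ_{i=1}^K c_i y^{σ_i} satisfies |h^{(p)}(y)| ≥ η |y|^{−p} Σ_{i=1}^K |c_i y^{σ_i}|, where h^{(p)} denotes the p-th derivative of h. -/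
open Finset in
theorem iteratedDeriv_sum_mul_pow {ι : Type*} (s : Finset ι) (c : ι → ℝ) (σ : ι → ℕ) (n : ℕ)
    {y : ℝ} (hy : y ≠ 0) :
    iteratedDeriv n (fun z : ℝ => ∑ i ∈ s, c i * z ^ σ i) y =
      y ^ (-(n : ℤ)) * ∑ i ∈ s, c i * y ^ σ i * ((σ i).descFactorial n : ℝ) := by
  rw [iteratedDeriv_fun_sum (fun i _ => by fun_prop), mul_sum]
  refine sum_congr rfl fun i _ => ?_
  rw [iteratedDeriv_const_mul_field, iteratedDeriv_pow, zpow_neg, zpow_natCast]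
  rcases le_or_gt n (σ i) with h | h
  · rw [pow_sub₀ y hy h]
    ring
  · simp [Nat.descFactorial_of_lt h]

theorem det_descFactorial_succ_ne_zero {K : ℕ} (σ : Fin K → ℕ) (hpos : ∀ i, 0 < σ i)
    (hinj : Function.Injective σ) :
    (Matrix.of fun i p : Fin K => ((σ i).descFactorial (p + 1) : ℝ)).det ≠ 0 := by
  have hfac : (Matrix.of fun i p : Fin K => ((σ i).descFactorial (p + 1) : ℝ)) =
      Matrix.of fun i p : Fin K => (σ i : ℝ) *
        (Matrix.of fun i p : Fin K => (descPochhammer ℝ p).eval ((σ i - 1 : ℕ) : ℝ)) i p := by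
    ext i p
    obtain ⟨m, hm⟩ := Nat.exists_eq_succ_of_ne_zero (hpos i).ne'
    simp [-Nat.descFactorial_succ, hm, descPochhammer_eval_eq_descFactorial,
      Nat.succ_descFactorial_succ]
  rw [hfac, Matrix.det_mul_column]
  refine mul_ne_zero (Finset.prod_ne_zero_iff.2 fun i _ => by exact_mod_cast (hpos i).ne') ?_
  have h := Matrix.det_eval_matrixOfPolynomials_eq_det_vandermonde
    (fun i => ((σ i - 1 : ℕ) : ℝ)) (fun p : Fin K => descPochhammer ℝ p)
    (fun p => descPochhammer_natDegree ℝ p) (fun p => monic_descPochhammer ℝ p)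
  rw [← h, Matrix.det_vandermonde_ne_zero_iff]
  intro i j hij
  have hij' : σ i - 1 = σ j - 1 := Nat.cast_injective (R := ℝ) hij
  have := hpos i
  have := hpos j
  exact hinj (by omega)

theorem Matrix.exists_pos_mul_sum_abs_le_abs_vecMul {K : ℕ} [NeZero K]
    (A : Matrix (Fin K) (Fin K) ℝ) (hA : A.det ≠ 0) :
    ∃ η : ℝ, 0 < η ∧ ∀ v : Fin K → ℝ, ∃ p, η * ∑ i, |v i| ≤ |A.vecMulLinear v p| := by
  have hker : LinearMap.ker A.vecMulLinear = ⊥ :=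
    LinearMap.ker_eq_bot'.2 fun v hv => Matrix.eq_zero_of_vecMul_eq_zero hA hv
  obtain ⟨C, hC, hlip⟩ := A.vecMulLinear.exists_antilipschitzWith hker
  have hK : (0 : ℝ) < K := by exact_mod_cast Nat.pos_of_neZero K
  have hC' : (0 : ℝ) < C := hC
  refine ⟨(K * C : ℝ)⁻¹, by positivity, fun v => ?_⟩
  obtain ⟨p, hp⟩ := Finite.exists_max fun p => |A.vecMulLinear v p|
  refine ⟨p, ?_⟩
  have hnorm : ‖A.vecMulLinear v‖ ≤ |A.vecMulLinear v p| :=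
    (pi_norm_le_iff_of_nonneg (abs_nonneg _)).2 hp
  have hv : ‖v‖ ≤ C * ‖A.vecMulLinear v‖ := by
    simpa using hlip.le_mul_dist v 0
  have hsum : ∑ i, |v i| ≤ K * ‖v‖ := by
    simpa using Finset.sum_le_card_nsmul Finset.univ (fun i => |v i|) ‖v‖
      fun i _ => norm_le_pi_norm v i
  rw [inv_mul_le_iff₀ (by positivity)]
  calc ∑ i, |v i| ≤ K * ‖v‖ := hsum
    _ ≤ K * (C * |A.vecMulLinear v p|) := by gcongr; exact hv.trans (by gcongr)
    _ = K * C * |A.vecMulLinear v p| := by ring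

/-- derivative lower bound for sums `h(y) = Σ cᵢ y^{σᵢ}` with distinct
positive integer exponents: some derivative of order `p ∈ {1,…,K}` satisfies
`|h^{(p)}(y)| ≥ η |y|^{-p} Σᵢ |cᵢ y^{σᵢ}|`. -/
theorem stmt18
    (K : ℕ) (hK : 1 ≤ K)
    (σ : Fin K → ℕ) (hpos : ∀ i, 0 < σ i) (hinj : Function.Injective σ) :
    ∃ η : ℝ, 0 < η ∧
      ∀ (c : Fin K → ℝ) (y : ℝ), y ≠ 0 →
        ∃ p : Fin K,
          η * |y| ^ (-(p.1 + 1 : ℤ)) * ∑ i, |c i * y ^ σ i| ≤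
            |iteratedDeriv (p.1 + 1) (fun z : ℝ => ∑ i, c i * z ^ σ i) y| := by
  have : NeZero K := ⟨by omega⟩
  obtain ⟨η, hη, h⟩ := Matrix.exists_pos_mul_sum_abs_le_abs_vecMul _
    (det_descFactorial_succ_ne_zero σ hpos hinj)
  refine ⟨η, hη, fun c y hy => ?_⟩
  obtain ⟨p, hp⟩ := h fun i => c i * y ^ σ i
  refine ⟨p, ?_⟩
  rw [iteratedDeriv_sum_mul_pow _ _ _ _ hy, abs_mul, abs_zpow, mul_comm η, mul_assoc]
  push_cast
  exact mul_le_mul_of_nonneg_left hp (by positivity)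
end
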